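/- Let κ > 0 and ṽ_1^κ(r) = i · D_1( exp(e^{-i 3π/4} κ r) - exp(e^{i 3π/4} κ r) ), with (D_1 w)(r) = w'(r) - w(r)/r. Then as r → 0⁺: ṽ_1^κ(r) → 0, (ṽ_1^κ)'(r) → -κ^2, (ṽ_1^κ)''(r) → (2√2/3) κ^3, and (ṽ_1^κ)'''(r) → 0. In particular the boundary values satisfy the condition (ṽ_1^κ)''(0) = -(2√2/3) κ (ṽ_1^κ)'(0) together with ṽ_1^κ(0) = (ṽ_1^κ)'''(0) = 0, so ṽ_1^κ lies in the domain of the self-adjoint extension T_{1κ}^2. -/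

import Mathlib

open Set Filter Topology

/-- The differential operation `(D_1 w)(r) = w'(r) - w(r)/r`. -/
noncomputable def D1 (w : ℝ → ℂ) : ℝ → ℂ :=
  fun r => deriv w r - w r / (r : ℂ)

/-- The eigenfunction `ṽ_1^κ = i D_1(exp(e^{-i3π/4} κ r) - exp(e^{i3π/4} κ r))`. -/
noncomputable def vTilde1 (κ : ℝ) : ℝ → ℂ :=
  fun r => Complex.I * D1 (fun s =>
    Complex.exp (Complex.exp (-Complex.I * (3 * Real.pi / 4)) * κ * s)
      - Complex.exp (Complex.exp (Complex.I * (3 * Real.pi / 4)) * κ * s)) r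

/-- If `h = c V + s V'` near `0` with `V` analytic, then `h' = (c + 1) V' + s V''` near `0`. -/
lemma eventuallyEq_deriv_of_euler {h h' V : ℝ → ℂ} {c : ℂ} (hV : AnalyticAt ℝ V 0)
    (hh : ∀ s, HasDerivAt h (h' s) s)
    (e : h =ᶠ[𝓝 0] fun s => c * V s + (s : ℂ) * deriv V s) :
    h' =ᶠ[𝓝 0] fun s => (c + 1) * deriv V s + (s : ℂ) * deriv (deriv V) s := by
  filter_upwards [e.eventuallyEq_nhds, hV.eventually_analyticAt] with s hs hVs
  have h1 : HasDerivAt (fun s => c * V s + (s : ℂ) * deriv V s)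
      (c * deriv V s + (1 * deriv V s + (s : ℂ) * deriv (deriv V) s)) s :=
    (hVs.differentiableAt.hasDerivAt.const_mul c).add
      ((HasDerivAt.ofReal_comp (hasDerivAt_id s)).mul hVs.deriv.differentiableAt.hasDerivAt)
  rw [(hh s).unique (h1.congr_of_eventuallyEq hs)]
  ring

/-- The `n`-th derivative of `s ↦ exp (a s) - exp (b s)`. -/
noncomputable def expDiff (a b : ℂ) (n : ℕ) (s : ℝ) : ℂ :=
  a ^ n * Complex.exp (a * s) - b ^ n * Complex.exp (b * s)

lemma hasDerivAt_expDiff (a b : ℂ) (n : ℕ) (s : ℝ) :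
    HasDerivAt (expDiff a b n) (expDiff a b (n + 1) s) s := by
  have key (c : ℂ) : HasDerivAt (fun s : ℝ => c ^ n * Complex.exp (c * s))
      (c ^ n * (Complex.exp (c * s) * (c * (1 : ℝ)))) s :=
    (((HasDerivAt.ofReal_comp (hasDerivAt_id s)).const_mul c).cexp).const_mul _
  refine ((key a).sub (key b)).congr_deriv ?_
  simp only [expDiff]
  push_cast
  ring

lemma expDiff_at_zero (a b : ℂ) (n : ℕ) : expDiff a b n 0 = a ^ n - b ^ n := by
  simp [expDiff]

lemma analyticAt_expDiff (a b : ℂ) (n : ℕ) (s : ℝ) : AnalyticAt ℝ (expDiff a b n) s := by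
  have key (c : ℂ) : AnalyticAt ℝ (fun s : ℝ => c ^ n * Complex.exp (c * s)) s :=
    analyticAt_const.mul ((analyticAt_cexp.restrictScalars (𝕜 := ℝ)).comp
      (analyticAt_const.mul (Complex.ofRealCLM.analyticAt s)))
  exact (key a).sub (key b)

lemma hasDerivAt_euler_expDiff (a b c : ℂ) (n : ℕ) (s : ℝ) :
    HasDerivAt (fun s : ℝ => Complex.I * (c * expDiff a b n s + s * expDiff a b (n + 1) s))
      (Complex.I * ((c + 1) * expDiff a b (n + 1) s + s * expDiff a b (n + 2) s)) s := by
  refine ((((hasDerivAt_expDiff a b n s).const_mul c).add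
    ((HasDerivAt.ofReal_comp (hasDerivAt_id s)).mul
      (hasDerivAt_expDiff a b (n + 1) s))).const_mul Complex.I).congr_deriv ?_
  simp only [id]
  push_cast
  ring

/-- The function `s ↦ i D_1 (exp (a s) - exp (b s))` extends analytically to `0`, with the
derivatives at `0` read off from the power series. -/
lemma exists_analyticAt_D1_expDiff (a b : ℂ) :
    ∃ V : ℝ → ℂ, AnalyticAt ℝ V 0 ∧
      (∀ s : ℝ, s ≠ 0 → Complex.I * D1 (expDiff a b 0) s = V s) ∧
      V 0 = 0 ∧ deriv V 0 = Complex.I * (a ^ 2 - b ^ 2) / 2 ∧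
      deriv (deriv V) 0 = Complex.I * (2 * (a ^ 3 - b ^ 3)) / 3 ∧
      deriv (deriv (deriv V)) 0 = Complex.I * (3 * (a ^ 4 - b ^ 4)) / 4 := by
  set h : ℝ → ℂ := fun s : ℝ =>
    Complex.I * ((-1) * expDiff a b 0 s + s * expDiff a b (0 + 1) s) with hdef
  have hh : AnalyticAt ℝ h 0 :=
    analyticAt_const.mul ((analyticAt_const.mul (analyticAt_expDiff a b 0 0)).add
      ((Complex.ofRealCLM.analyticAt 0).mul (analyticAt_expDiff a b 1 0)))
  have h0 : h 0 = 0 := by simp [hdef, expDiff_at_zero]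
  have hV : AnalyticAt ℝ (dslope h 0) 0 := by
    obtain ⟨p, hp⟩ := hh
    exact hp.has_fpower_series_dslope_fslope.analyticAt
  have hmul (s : ℝ) : h s = s * dslope h 0 s := by
    have := sub_smul_dslope h 0 s
    rw [h0, sub_zero, sub_zero, Complex.real_smul] at this
    exact this.symm
  have d1 := hasDerivAt_euler_expDiff a b (-1) 0
  have d2 := hasDerivAt_euler_expDiff a b (-1 + 1) 1
  have d3 := hasDerivAt_euler_expDiff a b (-1 + 1 + 1) 2
  have d4 := hasDerivAt_euler_expDiff a b (-1 + 1 + 1 + 1) 3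
  generalize dslope h 0 = V at hV hmul
  have e1 : (fun s : ℝ => Complex.I * ((-1 + 1) * expDiff a b (0 + 1) s
      + s * expDiff a b (0 + 2) s)) =ᶠ[𝓝 0] fun s => 1 * V s + (s : ℂ) * deriv V s := by
    filter_upwards [hV.eventually_analyticAt] with s hs
    have := ((HasDerivAt.ofReal_comp (hasDerivAt_id s)).mul
      hs.differentiableAt.hasDerivAt).congr_of_eventuallyEq (f₁ := h) (.of_forall hmul)
    simpa using (d1 s).unique this
  have e2 := eventuallyEq_deriv_of_euler hV d2 e1
  have e3 := eventuallyEq_deriv_of_euler hV.deriv d3 e2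
  have e4 := eventuallyEq_deriv_of_euler hV.deriv.deriv d4 e3
  refine ⟨V, hV, fun s hs => ?_, ?_, ?_, ?_, ?_⟩
  · have hs' : (s : ℂ) ≠ 0 := by exact_mod_cast hs
    have := hmul s
    simp only [D1, (hasDerivAt_expDiff a b 0 s).deriv]
    apply mul_left_cancel₀ hs'
    rw [← this, hdef]
    field_simp
    ring
  · simpa using e1.eq_of_nhds.symm
  · have := e2.eq_of_nhds
    simp only [expDiff_at_zero, Complex.ofReal_zero] at this
    linear_combination (-1 / 2) * this
  · have := e3.eq_of_nhds
    simp only [expDiff_at_zero, Complex.ofReal_zero] at this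
    linear_combination (-1 / 3) * this
  · have := e4.eq_of_nhds
    simp only [expDiff_at_zero, Complex.ofReal_zero] at this
    linear_combination (-1 / 4) * this

lemma tendsto_nhdsGT_of_eqOn {f V : ℝ → ℂ} (e : EqOn f V (Ioi 0)) (hV : AnalyticAt ℝ V 0) :
    Tendsto f (𝓝[>] 0) (𝓝 (V 0)) :=
  (hV.continuousAt.tendsto.mono_left nhdsWithin_le_nhds).congr'
    (eventually_mem_nhdsWithin.mono fun _ hs => (e hs).symm)

lemma exp_I_mul_three_pi_div_four :
    Complex.exp (Complex.I * (3 * Real.pi / 4)) =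
      ((Real.sqrt 2 / 2 : ℝ) : ℂ) * (-1 + Complex.I) := by
  have h : (Complex.I * (3 * Real.pi / 4) : ℂ) = ((Real.pi - Real.pi / 4 : ℝ) : ℂ) * Complex.I := by
    push_cast; ring
  rw [h, Complex.exp_mul_I, ← Complex.ofReal_cos, ← Complex.ofReal_sin, Real.cos_pi_sub,
    Real.sin_pi_sub, Real.cos_pi_div_four, Real.sin_pi_div_four]
  push_cast; ring

lemma exp_neg_I_mul_three_pi_div_four :
    Complex.exp (-Complex.I * (3 * Real.pi / 4)) =
      ((Real.sqrt 2 / 2 : ℝ) : ℂ) * (-1 - Complex.I) := by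
  have h : (-Complex.I * (3 * Real.pi / 4) : ℂ) =
      ((-(Real.pi - Real.pi / 4) : ℝ) : ℂ) * Complex.I := by
    push_cast; ring
  rw [h, Complex.exp_mul_I, ← Complex.ofReal_cos, ← Complex.ofReal_sin, Real.cos_neg,
    Real.sin_neg, Real.cos_pi_sub,
    Real.sin_pi_sub, Real.cos_pi_div_four, Real.sin_pi_div_four]
  push_cast; ring

/-- Boundary behaviour of `ṽ_1^κ` as `r → 0⁺`: `ṽ_1^κ → 0`, `(ṽ_1^κ)' → -κ²`,
`(ṽ_1^κ)'' → (2√2/3) κ³`, `(ṽ_1^κ)''' → 0`; so `ṽ_1^κ` satisfies the boundary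
conditions `u''(0) = -(2√2/3) κ u'(0)`, `u(0) = u'''(0) = 0` defining the
domain of the self-adjoint extension `T_{1κ}²`. -/
theorem stmt14 (κ : ℝ) (hκ : 0 < κ) :
    Tendsto (vTilde1 κ) (nhdsWithin 0 (Ioi 0)) (nhds 0) ∧
    Tendsto (deriv (vTilde1 κ)) (nhdsWithin 0 (Ioi 0)) (nhds (-(κ : ℂ) ^ 2)) ∧
    Tendsto (deriv (deriv (vTilde1 κ))) (nhdsWithin 0 (Ioi 0))
      (nhds (((2 * Real.sqrt 2 / 3 * κ ^ 3 : ℝ) : ℂ))) ∧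
    Tendsto (deriv (deriv (deriv (vTilde1 κ)))) (nhdsWithin 0 (Ioi 0)) (nhds 0) := by
  set a : ℂ := Complex.exp (-Complex.I * (3 * Real.pi / 4)) * κ with ha
  set b : ℂ := Complex.exp (Complex.I * (3 * Real.pi / 4)) * κ with hb
  obtain ⟨V, hV, e, v0, v1, v2, v3⟩ := exists_analyticAt_D1_expDiff a b
  have hv : vTilde1 κ = fun s => Complex.I * D1 (expDiff a b 0) s := by
    unfold vTilde1 expDiff
    simp only [pow_zero, one_mul, ha, hb]
  have E0 : EqOn (vTilde1 κ) V (Ioi 0) := fun s hs => by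
    rw [hv]; exact e s (ne_of_gt hs)
  have E1 := E0.deriv isOpen_Ioi
  have E2 := E1.deriv isOpen_Ioi
  have E3 := E2.deriv isOpen_Ioi
  rw [exp_neg_I_mul_three_pi_div_four] at ha
  rw [exp_I_mul_three_pi_div_four] at hb
  have hI : Complex.I ^ 2 = -1 := Complex.I_sq
  have hq : ((Real.sqrt 2 : ℝ) : ℂ) ^ 2 = 2 := by
    exact_mod_cast Real.sq_sqrt (zero_le_two : (0 : ℝ) ≤ 2)
  have hI4 : Complex.I ^ 4 = 1 := Complex.I_pow_four
  push_cast at ha hb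
  have w1 : Complex.I * (a ^ 2 - b ^ 2) / 2 = -(κ : ℂ) ^ 2 := by
    rw [ha, hb]
    linear_combination (κ : ℂ) ^ 2 * (Real.sqrt 2 : ℂ) ^ 2 / 2 * hI - (κ : ℂ) ^ 2 / 2 * hq
  have w2 : Complex.I * (2 * (a ^ 3 - b ^ 3)) / 3
      = ((2 * Real.sqrt 2 / 3 * κ ^ 3 : ℝ) : ℂ) := by
    rw [ha, hb]
    push_cast
    linear_combination (-(κ : ℂ) ^ 3 * (Real.sqrt 2 : ℂ) ^ 3 / 6 * (3 + Complex.I ^ 2 - 1)) * hI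
      + (κ : ℂ) ^ 3 * (Real.sqrt 2 : ℂ) / 3 * hq
  have w3 : Complex.I * (3 * (a ^ 4 - b ^ 4)) / 4 = 0 := by
    rw [ha, hb]
    linear_combination 3 / 8 * (κ : ℂ) ^ 4 * (Real.sqrt 2 : ℂ) ^ 4 * Complex.I ^ 2 * hI
  rw [← w1, ← w2, ← v1, ← v2]
  refine ⟨?_, tendsto_nhdsGT_of_eqOn E1 hV.deriv, tendsto_nhdsGT_of_eqOn E2 hV.deriv.deriv, ?_⟩
  · simpa only [v0] using tendsto_nhdsGT_of_eqOn E0 hV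
  · simpa only [v3, w3] using tendsto_nhdsGT_of_eqOn E3 hV.deriv.deriv.deriv
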